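/- Suppose the operator L satisfies the positive maximum principle on M₊(E). Then for all g ∈ C(E) and all ν ∈ M₊(E) one has ⟨q₁(g,g),ν⟩ ≥ 0 and ⟨q₂(g,g),ν²⟩ ≥ 0; moreover, if g ≥ 0 and g ≡ 0 on supp(ν), then ⟨q₁(g,g),ν⟩ = 0 and ⟨q₂(g,g),ν²⟩ = 0. -/

import Mathlib

open MeasureTheory Topology

/-- The topological support of a measure: points all of whose open neighborhoods
have positive measure. -/
def mSupport {E : Type*} [TopologicalSpace E] [MeasurableSpace E]
    (ν : Measure E) : Set E :=
  {x : E | ∀ U : Set E, IsOpen U → x ∈ U → 0 < ν U}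

/-- The action of the operator `L` (with parameters `b₀, b₁, q₀, q₁, q₂`) on the cylindrical
function `ν ↦ φ(⟨g₁,ν⟩, …, ⟨g_m,ν⟩)`, evaluated at `ν`. -/
noncomputable def Lapp {E : Type*} [MetricSpace E] [MeasurableSpace E]
    (b₀ : C(E, ℝ) →ₗ[ℝ] ℝ) (b₁ : C(E, ℝ) →ₗ[ℝ] C(E, ℝ))
    (q₀ : C(E, ℝ) →ₗ[ℝ] C(E, ℝ) →ₗ[ℝ] ℝ)
    (q₁ : C(E, ℝ) →ₗ[ℝ] C(E, ℝ) →ₗ[ℝ] C(E, ℝ))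
    (q₂ : C(E, ℝ) →ₗ[ℝ] C(E, ℝ) →ₗ[ℝ] C(E × E, ℝ))
    (m : ℕ) (φ : (Fin m → ℝ) → ℝ) (g : Fin m → C(E, ℝ)) (ν : FiniteMeasure E) : ℝ :=
  (∑ i, fderiv ℝ φ (fun k => ∫ x, g k x ∂(ν : Measure E)) (Pi.single i 1) *
      (b₀ (g i) + ∫ x, b₁ (g i) x ∂(ν : Measure E))) +
  (1 / 2) * ∑ i, ∑ j,
    (fderiv ℝ (fun w => fderiv ℝ φ w (Pi.single i 1))
        (fun k => ∫ x, g k x ∂(ν : Measure E)) (Pi.single j 1)) *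
      (q₀ (g i) (g j) + (∫ x, q₁ (g i) (g j) x ∂(ν : Measure E)) +
        ∫ p, q₂ (g i) (g j) p ∂((ν : Measure E).prod (ν : Measure E)))

/-- `φ : ℝ^m → ℝ` is a polynomial function. -/
def IsPolyFn {m : ℕ} (φ : (Fin m → ℝ) → ℝ) : Prop :=
  ∃ P : MvPolynomial (Fin m) ℝ, ∀ v, φ v = MvPolynomial.eval v P

/-- The operator `L` satisfies the positive maximum principle on `M₊(E)`: for every
cylindrical function `f(ν) = φ(⟨g₁,ν⟩, …, ⟨g_m,ν⟩)` whose outer function `φ` is smooth and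
either a polynomial or compactly supported, and every global maximizer `ν*` of `f` over
`M₊(E)` with `f(ν*) ≥ 0`, one has `Lf(ν*) ≤ 0`. -/
def SatisfiesPMP {E : Type*} [MetricSpace E] [MeasurableSpace E]
    (b₀ : C(E, ℝ) →ₗ[ℝ] ℝ) (b₁ : C(E, ℝ) →ₗ[ℝ] C(E, ℝ))
    (q₀ : C(E, ℝ) →ₗ[ℝ] C(E, ℝ) →ₗ[ℝ] ℝ)
    (q₁ : C(E, ℝ) →ₗ[ℝ] C(E, ℝ) →ₗ[ℝ] C(E, ℝ))
    (q₂ : C(E, ℝ) →ₗ[ℝ] C(E, ℝ) →ₗ[ℝ] C(E × E, ℝ)) : Prop :=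
  ∀ (m : ℕ) (φ : (Fin m → ℝ) → ℝ), ContDiff ℝ (⊤ : ℕ∞) φ →
    (IsPolyFn φ ∨ HasCompactSupport φ) →
    ∀ (g : Fin m → C(E, ℝ)) (νstar : FiniteMeasure E),
      (∀ ν : FiniteMeasure E,
        φ (fun i => ∫ x, g i x ∂(ν : Measure E)) ≤
          φ (fun i => ∫ x, g i x ∂(νstar : Measure E))) →
      0 ≤ φ (fun i => ∫ x, g i x ∂(νstar : Measure E)) →
      Lapp b₀ b₁ q₀ q₁ q₂ m φ g νstar ≤ 0

namespace PositiveMaximumPrinciple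

lemma isPolyFn_polynomial_eval (p : Polynomial ℝ) :
    IsPolyFn (fun v : Fin 1 → ℝ => p.eval (v 0)) := by
  refine ⟨Polynomial.aeval (MvPolynomial.X 0) p, fun v => ?_⟩
  have h := Polynomial.hom_eval₂ p (algebraMap ℝ (MvPolynomial (Fin 1) ℝ))
    (MvPolynomial.eval v) (MvPolynomial.X 0)
  rw [Polynomial.aeval_def, h, MvPolynomial.eval_X]
  have hc : (MvPolynomial.eval v).comp (algebraMap ℝ (MvPolynomial (Fin 1) ℝ))
      = RingHom.id ℝ := by
    ext r
    simp [MvPolynomial.algebraMap_eq]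
  rw [hc]
  rfl

lemma fderiv_polynomial_eval (p : Polynomial ℝ) (w : Fin 1 → ℝ) :
    fderiv ℝ (fun v : Fin 1 → ℝ => p.eval (v 0)) w (Pi.single 0 1) = p.derivative.eval (w 0) := by
  have h := (p.hasDerivAt (w 0)).comp_hasFDerivAt w
    (ContinuousLinearMap.proj (R := ℝ) (φ := fun _ : Fin 1 => ℝ) 0).hasFDerivAt
  have h' : HasFDerivAt (fun v : Fin 1 → ℝ => p.eval (v 0)) _ w := h
  rw [h'.fderiv]
  simp

section

variable {E : Type*} [MetricSpace E] [MeasurableSpace E]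
  {b₀ : C(E, ℝ) →ₗ[ℝ] ℝ} {b₁ : C(E, ℝ) →ₗ[ℝ] C(E, ℝ)}
  {q₀ : C(E, ℝ) →ₗ[ℝ] C(E, ℝ) →ₗ[ℝ] ℝ}
  {q₁ : C(E, ℝ) →ₗ[ℝ] C(E, ℝ) →ₗ[ℝ] C(E, ℝ)}
  {q₂ : C(E, ℝ) →ₗ[ℝ] C(E, ℝ) →ₗ[ℝ] C(E × E, ℝ)}

/-- The positive maximum principle for outer functions that are polynomials in one variable. -/
lemma _root_.SatisfiesPMP.polynomial_le (hPMP : SatisfiesPMP b₀ b₁ q₀ q₁ q₂)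
    (p : Polynomial ℝ) (g : C(E, ℝ)) (ν : FiniteMeasure E)
    (hmax : ∀ μ : FiniteMeasure E,
      p.eval (∫ x, g x ∂(μ : Measure E)) ≤ p.eval (∫ x, g x ∂(ν : Measure E)))
    (hpos : 0 ≤ p.eval (∫ x, g x ∂(ν : Measure E))) :
    p.derivative.eval (∫ x, g x ∂(ν : Measure E)) *
        (b₀ g + ∫ x, b₁ g x ∂(ν : Measure E)) +
      1 / 2 * (p.derivative.derivative.eval (∫ x, g x ∂(ν : Measure E)) *
        (q₀ g g + (∫ x, q₁ g g x ∂(ν : Measure E)) +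
          ∫ z, q₂ g g z ∂((ν : Measure E).prod (ν : Measure E)))) ≤ 0 := by
  have hsmooth : ContDiff ℝ (⊤ : ℕ∞) (fun v : Fin 1 → ℝ => p.eval (v 0)) :=
    (p.contDiff_aeval _).comp (contDiff_apply ℝ ℝ 0)
  have h := hPMP 1 (fun v => p.eval (v 0)) hsmooth (Or.inl (isPolyFn_polynomial_eval p))
    (fun _ => g) ν hmax hpos
  simpa only [Lapp, Finset.univ_unique, Fin.default_eq_zero, Finset.sum_singleton,
    fderiv_polynomial_eval, Fin.isValue] using h

lemma _root_.SatisfiesPMP.quadratic_nonneg (hPMP : SatisfiesPMP b₀ b₁ q₀ q₁ q₂)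
    (g : C(E, ℝ)) (ν : FiniteMeasure E) :
    0 ≤ q₀ g g + (∫ x, q₁ g g x ∂(ν : Measure E)) +
      ∫ z, q₂ g g z ∂((ν : Measure E).prod (ν : Measure E)) := by
  have h := hPMP.polynomial_le
    (-(Polynomial.X - Polynomial.C (∫ x, g x ∂(ν : Measure E))) ^ 2) g ν
    (fun μ => by simp; positivity) (by simp)
  simp [Polynomial.derivative_pow] at h
  linarith

/-- A nonnegative test function integrating to zero is annihilated from above: test against
`v ↦ -v + K v² - K² v³`, which is maximal at `0` on the half-line and has arbitrarily large second
derivative there. -/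
lemma _root_.SatisfiesPMP.quadratic_nonpos (hPMP : SatisfiesPMP b₀ b₁ q₀ q₁ q₂)
    (g : C(E, ℝ)) (hg : ∀ x, 0 ≤ g x) (ν : FiniteMeasure E)
    (hν : ∫ x, g x ∂(ν : Measure E) = 0) :
    q₀ g g + (∫ x, q₁ g g x ∂(ν : Measure E)) +
      ∫ z, q₂ g g z ∂((ν : Measure E).prod (ν : Measure E)) ≤ 0 := by
  set Q := q₀ g g + (∫ x, q₁ g g x ∂(ν : Measure E)) +
      ∫ z, q₂ g g z ∂((ν : Measure E).prod (ν : Measure E)) with hQ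
  set B := b₀ g + ∫ x, b₁ g x ∂(ν : Measure E) with hB
  have key : ∀ K : ℝ, K * Q ≤ B := by
    intro K
    have h := hPMP.polynomial_le
      (-Polynomial.X + Polynomial.C K * Polynomial.X ^ 2
        - Polynomial.C (K ^ 2) * Polynomial.X ^ 3) g ν
      (fun μ => by
        have hx : 0 ≤ ∫ x, g x ∂(μ : Measure E) := integral_nonneg hg
        rw [hν]
        generalize ∫ x, g x ∂(μ : Measure E) = x at hx
        simp
        nlinarith [mul_nonneg hx (sq_nonneg (2 * K * x - 1)), mul_nonneg hx (sq_nonneg (K * x))])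
      (by simp [hν])
    simp only [hν, ← hQ, ← hB] at h
    simp [Polynomial.derivative_pow] at h
    linarith
  by_contra! hlt
  have h := key ((B + 1) / Q)
  rw [div_mul_cancel₀ _ hlt.ne'] at h
  linarith

lemma _root_.SatisfiesPMP.constant_part_eq_zero (hPMP : SatisfiesPMP b₀ b₁ q₀ q₁ q₂)
    (g : C(E, ℝ)) : q₀ g g = 0 := by
  have hnonneg : ∀ h : C(E, ℝ), (∀ x, 0 ≤ h x) → q₀ h h = 0 := fun h hh =>
    le_antisymm (by simpa using hPMP.quadratic_nonpos h hh 0 (by simp))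
      (by simpa using hPMP.quadratic_nonneg h 0)
  have h₁ := hnonneg |g| (fun x => by simp)
  have h₂ := hnonneg (|g| + g) (fun x => by simpa using neg_le_iff_add_nonneg'.1 (neg_abs_le (g x)))
  have h₃ := hnonneg (|g| - g) (fun x => by simpa using le_abs_self (g x))
  simp only [map_add, map_sub, LinearMap.add_apply, LinearMap.sub_apply] at h₂ h₃
  linarith

lemma _root_.SatisfiesPMP.scaled_nonneg (hPMP : SatisfiesPMP b₀ b₁ q₀ q₁ q₂)
    (g : C(E, ℝ)) (ν : FiniteMeasure E) {t : ℝ} (ht : 0 < t) :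
    0 ≤ (∫ x, q₁ g g x ∂(ν : Measure E)) +
      t * ∫ z, q₂ g g z ∂((ν : Measure E).prod (ν : Measure E)) := by
  lift t to NNReal using ht.le
  have h := hPMP.quadratic_nonneg g (t • ν)
  rw [hPMP.constant_part_eq_zero g, FiniteMeasure.toMeasure_smul, Measure.prod_smul_left,
    Measure.prod_smul_right] at h
  simp only [integral_smul_nnreal_measure, zero_add, NNReal.smul_def, smul_eq_mul] at h
  refine nonneg_of_mul_nonneg_right (b := _) (a := (t : ℝ)) ?_ ht
  linarith

/-- Letting the scale tend to zero and to infinity separates the linear from the quadratic part. -/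
lemma nonneg_of_forall_pos_add_mul_nonneg {a b : ℝ} (h : ∀ t : ℝ, 0 < t → 0 ≤ a + t * b) :
    0 ≤ a ∧ 0 ≤ b := by
  constructor
  · by_contra! ha
    have hb : 0 < |b| + 1 := by positivity
    have h' := h (-a / (2 * (|b| + 1))) (div_pos (by linarith) (by positivity))
    have h2 : -a / (2 * (|b| + 1)) * b ≤ -a / 2 := by
      rw [div_mul_eq_mul_div, div_le_div_iff₀ (by positivity) two_pos]
      nlinarith [le_abs_self b]
    linarith
  · by_contra! hb
    have h' := h ((|a| + 1) / -b) (div_pos (by positivity) (by linarith))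
    have h2 : (|a| + 1) / -b * b = -(|a| + 1) := by
      field_simp [hb.ne]
    linarith [le_abs_self a]

lemma _root_.SatisfiesPMP.parts_nonneg (hPMP : SatisfiesPMP b₀ b₁ q₀ q₁ q₂)
    (g : C(E, ℝ)) (ν : FiniteMeasure E) :
    0 ≤ ∫ x, q₁ g g x ∂(ν : Measure E) ∧
      0 ≤ ∫ z, q₂ g g z ∂((ν : Measure E).prod (ν : Measure E)) :=
  nonneg_of_forall_pos_add_mul_nonneg fun _ ht => hPMP.scaled_nonneg g ν ht

end

lemma integral_eq_zero_of_eq_zero_on_mSupport {E : Type*} [TopologicalSpace E]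
    [SecondCountableTopology E] [MeasurableSpace E] (μ : Measure E) {g : E → ℝ}
    (hg : ∀ x ∈ mSupport μ, g x = 0) : ∫ x, g x ∂μ = 0 := by
  refine integral_eq_zero_of_ae (ae_iff.2 ?_)
  refine measure_null_of_locally_null _ fun x hx => ?_
  have hxs : x ∉ mSupport μ := fun h => hx (hg x h)
  simp only [mSupport, Set.mem_ofPred_eq, not_forall, not_lt, nonpos_iff_eq_zero] at hxs
  obtain ⟨U, hU, hxU, hμ⟩ := hxs
  exact ⟨U, mem_nhdsWithin_of_mem_nhds (hU.mem_nhds hxU), hμ⟩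

end PositiveMaximumPrinciple

/-- If `L` satisfies the positive maximum principle on `M₊(E)`, then `⟨q₁(g,g),ν⟩ ≥ 0` and
`⟨q₂(g,g),ν²⟩ ≥ 0` for all `g` and `ν`, with both vanishing when `g ≥ 0` vanishes on the
support of `ν`. -/
theorem stmt_11 {E : Type*} [MetricSpace E] [CompactSpace E] [MeasurableSpace E] [BorelSpace E]
    (b₀ : C(E, ℝ) →ₗ[ℝ] ℝ) (b₁ : C(E, ℝ) →ₗ[ℝ] C(E, ℝ))
    (q₀ : C(E, ℝ) →ₗ[ℝ] C(E, ℝ) →ₗ[ℝ] ℝ)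
    (q₁ : C(E, ℝ) →ₗ[ℝ] C(E, ℝ) →ₗ[ℝ] C(E, ℝ))
    (q₂ : C(E, ℝ) →ₗ[ℝ] C(E, ℝ) →ₗ[ℝ] C(E × E, ℝ))
    (hq₀ : ∀ g h : C(E, ℝ), q₀ g h = q₀ h g)
    (hq₁ : ∀ g h : C(E, ℝ), q₁ g h = q₁ h g)
    (hq₂ : ∀ g h : C(E, ℝ), q₂ g h = q₂ h g)
    (hq₂val : ∀ (g h : C(E, ℝ)) (x y : E), q₂ g h (x, y) = q₂ g h (y, x))
    (hPMP : SatisfiesPMP b₀ b₁ q₀ q₁ q₂) :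
    (∀ (g : C(E, ℝ)) (ν : FiniteMeasure E),
      0 ≤ ∫ x, q₁ g g x ∂(ν : Measure E) ∧
      0 ≤ ∫ p, q₂ g g p ∂((ν : Measure E).prod (ν : Measure E))) ∧
    (∀ (g : C(E, ℝ)) (ν : FiniteMeasure E), (∀ x, 0 ≤ g x) →
      (∀ x ∈ mSupport (ν : Measure E), g x = 0) →
      (∫ x, q₁ g g x ∂(ν : Measure E)) = 0 ∧
      (∫ p, q₂ g g p ∂((ν : Measure E).prod (ν : Measure E))) = 0) := by
  refine ⟨hPMP.parts_nonneg, fun g ν hg hsupp => ?_⟩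
  have hzero :=
    PositiveMaximumPrinciple.integral_eq_zero_of_eq_zero_on_mSupport (ν : Measure E) hsupp
  have hle := hPMP.quadratic_nonpos g hg ν hzero
  rw [hPMP.constant_part_eq_zero g, zero_add] at hle
  obtain ⟨h₁, h₂⟩ := hPMP.parts_nonneg g ν
  constructor <;> linarith
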